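/- For every x ∈ ℝ, Φ(x) − min_{x'∈[0,1]} Φ(x') = W(π(x)) − min_{y∈𝕋} W(y), where π : ℝ → 𝕋 is the canonical projection; that is, the geometric transform Φ of S and the Freidlin–Wentzell quasipotential W coincide up to an additive constant. -/

import Mathlib

open Set Filter Topology


/-- Following a tree to the root, every vertex is covered on one side. -/
lemma tree_cover {ι : Type*} [Fintype ι] [DecidableEq ι] (g : ι → ι) (i : ι)
    (hreach : ∀ j, ∃ n, g^[n] j = i) (P N φ ψ : ι → ℝ) (hP : ∀ j, 0 ≤ P j) (hN : ∀ j, 0 ≤ N j)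
    (hstep : ∀ j, j ≠ i → (φ j ≤ φ (g j) + P j ∧ ψ j ≤ ψ (g j) + N j) ∨ φ j ≤ P j ∨ ψ j ≤ N j)
    (hroot : φ i ≤ P i ∨ ψ i ≤ N i) :
    ∀ j, φ j ≤ ∑ k, P k ∨ ψ j ≤ ∑ k, N k := by
  classical
  let d : ι → ℕ := fun j => Nat.find (hreach j)
  have hd0 : ∀ j, d j = 0 → j = i := by
    intro j h
    have := Nat.find_spec (hreach j)
    change g^[d j] j = i at this
    rw [h] at this
    simpa using this
  have hds : ∀ j, j ≠ i → d (g j) < d j := by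
    intro j hj
    have h := Nat.find_spec (hreach j)
    change g^[d j] j = i at h
    obtain ⟨m, hm⟩ : ∃ m, d j = m + 1 :=
      Nat.exists_eq_succ_of_ne_zero (fun h0 => hj (hd0 j h0))
    rw [hm, Function.iterate_succ_apply] at h
    have : d (g j) ≤ m := Nat.find_min' (hreach (g j)) h
    omega
  have hsub : ∀ (Q : ι → ℝ), (∀ j, 0 ≤ Q j) → ∀ j, Q j ≤ ∑ k with d k ≤ d j, Q k := by
    intro Q hQ j
    exact Finset.single_le_sum (f := Q) (fun k _ => hQ k) (by simp)
  have hadd : ∀ (Q : ι → ℝ), (∀ j, 0 ≤ Q j) → ∀ j, j ≠ i →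
      (∑ k with d k ≤ d (g j), Q k) + Q j ≤ ∑ k with d k ≤ d j, Q k := by
    intro Q hQ j hj
    have h1 : j ∉ (Finset.univ.filter fun k => d k ≤ d (g j)) := by
      simp [hds j hj]
    rw [add_comm, ← Finset.sum_insert h1]
    apply Finset.sum_le_sum_of_subset_of_nonneg
    · intro k hk
      simp only [Finset.mem_insert, Finset.mem_filter, Finset.mem_univ, true_and] at hk ⊢
      rcases hk with rfl | hk
      · exact le_rfl
      · exact hk.trans (hds j hj).le
    · intro k _ _; exact hQ k
  have main : ∀ n, ∀ j, d j = n →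
      (φ j ≤ ∑ k with d k ≤ d j, P k) ∨ (ψ j ≤ ∑ k with d k ≤ d j, N k) := by
    intro n
    induction n using Nat.strong_induction_on with
    | _ n ih =>
      intro j hj
      by_cases hji : j = i
      · subst hji
        rcases hroot with h | h
        · left; exact h.trans (hsub P hP j)
        · right; exact h.trans (hsub N hN j)
      · rcases hstep j hji with ⟨h1, h2⟩ | h | h
        · rcases ih (d (g j)) (hj ▸ hds j hji) (g j) rfl with h | h
          · left; linarith [hadd P hP j hji]
          · right; linarith [hadd N hN j hji]
        · left; exact h.trans (hsub P hP j)
        · right; exact h.trans (hsub N hN j)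
  intro j
  rcases main _ j rfl with h | h
  · left
    exact h.trans (Finset.sum_le_sum_of_subset_of_nonneg (Finset.filter_subset _ _)
      (fun k _ _ => hP k))
  · right
    exact h.trans (Finset.sum_le_sum_of_subset_of_nonneg (Finset.filter_subset _ _)
      (fun k _ _ => hN k))

/-- The explicit tree obtained by cutting the cycle between positions `m-1` and `m`. -/
lemma cut_tree {ι : Type*} [Fintype ι] [DecidableEq ι] (n : ℕ) (σ : Fin (n + 1) ≃ ι)
    (C : ι → ι → ℝ) (d0 : ℝ) (ψ φ : ℕ → ℝ) (A B : ℝ) (m : ℕ) (hm1 : 1 ≤ m) (hmn : m ≤ n + 1)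
    (hd : d0 ≤ ψ 0)
    (hdown : ∀ k (hk : k + 1 < n + 1), C (σ ⟨k + 1, hk⟩) (σ ⟨k, by omega⟩) ≤ ψ (k + 1) - ψ k)
    (hup : ∀ k (hk : k + 1 < n + 1), C (σ ⟨k, by omega⟩) (σ ⟨k + 1, hk⟩) ≤ φ k - φ (k + 1))
    (hwrap : m < n + 1 → C (σ ⟨n, by omega⟩) (σ 0) ≤ φ n)
    (hA : ∀ k < m, ψ k ≤ A) (hB : ∀ k, m ≤ k → k < n + 1 → φ k ≤ B) (hB0 : 0 ≤ B) :
    ∃ f : ι → ι, (∀ j, ∃ N, f^[N] j = σ 0) ∧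
      (∑ j ∈ Finset.univ.erase (σ 0), C j (f j)) + d0 ≤ A + B := by
  let f0 : Fin (n + 1) → Fin (n + 1) := fun k =>
    if k.1 < m then ⟨k.1 - 1, by omega⟩ else if h : k.1 + 1 < n + 1 then ⟨k.1 + 1, h⟩ else 0
  have hlow : ∀ t : ℕ, ∀ k : Fin (n + 1), k.1 = t → t < m → ∃ N, f0^[N] k = 0 := by
    intro t
    induction t with
    | zero => intro k hk _; exact ⟨0, Fin.ext hk⟩
    | succ t ih =>
      intro k hk ht
      have hf : (f0 k).1 = t := by simp [f0, hk, ht]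
      obtain ⟨N, hN⟩ := ih (f0 k) hf (by omega)
      exact ⟨N + 1, by rw [Function.iterate_succ_apply]; exact hN⟩
  have hhigh : ∀ t : ℕ, ∀ k : Fin (n + 1), n - k.1 = t → m ≤ k.1 → ∃ N, f0^[N] k = 0 := by
    intro t
    induction t with
    | zero =>
      intro k hk hm
      refine ⟨1, ?_⟩
      have h1 : ¬ k.1 < m := by omega
      have h2 : ¬ k.1 + 1 < n + 1 := by omega
      simp only [Function.iterate_one, f0, if_neg h1, dif_neg h2]
    | succ t ih =>
      intro k hk hm
      have h1 : ¬ k.1 < m := by omega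
      have h2 : k.1 + 1 < n + 1 := by omega
      have hf : f0 k = ⟨k.1 + 1, h2⟩ := by simp only [f0, if_neg h1, dif_pos h2]
      obtain ⟨N, hN⟩ := ih (f0 k) (by rw [hf]; simp only; omega) (by rw [hf]; simp only; omega)
      exact ⟨N + 1, by rw [Function.iterate_succ_apply]; exact hN⟩
  let f : ι → ι := fun j => σ (f0 (σ.symm j))
  have hfit : ∀ N j, f^[N] j = σ (f0^[N] (σ.symm j)) := by
    intro N
    induction N with
    | zero => intro j; simp
    | succ N ih => intro j; rw [Function.iterate_succ_apply, ih, Function.iterate_succ_apply]; simp [f]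
  refine ⟨f, ?_, ?_⟩
  · intro j
    have : ∃ N, f0^[N] (σ.symm j) = 0 := by
      by_cases h : (σ.symm j).1 < m
      · exact hlow _ _ rfl h
      · exact hhigh _ _ rfl (by omega)
    obtain ⟨N, hN⟩ := this
    exact ⟨N, by rw [hfit, hN]⟩
  · -- costs
    let D : ℕ → ℝ := fun k =>
      if k = 0 then ψ 0 else if k < m then ψ k - ψ (k - 1) else
        φ k - (if k + 1 < n + 1 then φ (k + 1) else 0)
    have hD : ∀ k : Fin (n + 1), k ≠ 0 → C (σ k) (f (σ k)) ≤ D k.1 := by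
      intro k hk
      have hk0 : k.1 ≠ 0 := fun h => hk (Fin.ext h)
      have hfk : f (σ k) = σ (f0 k) := by simp [f]
      rw [hfk]
      simp only [D, if_neg hk0]
      by_cases h : k.1 < m
      · rw [if_pos h]
        obtain ⟨k, hkn⟩ := k
        obtain ⟨t, rfl⟩ := Nat.exists_eq_succ_of_ne_zero hk0
        simp only at h
        have := hdown t hkn
        have e : f0 ⟨t + 1, hkn⟩ = ⟨t, by omega⟩ := by simp [f0, h]
        rw [e]
        simpa using this
      · rw [if_neg h]
        by_cases h2 : k.1 + 1 < n + 1
        · have e : f0 k = ⟨k.1 + 1, h2⟩ := by simp only [f0, if_neg h, dif_pos h2]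
          rw [e, if_pos h2]
          exact hup k.1 h2
        · have e : f0 k = 0 := by simp only [f0, if_neg h, dif_neg h2]
          rw [e, if_neg h2]
          have hkn : k = ⟨n, by omega⟩ := Fin.ext (by simp only; omega)
          have := hwrap (by omega)
          rw [hkn]; simpa using this
    have hsum : (∑ j ∈ Finset.univ.erase (σ 0), C j (f j)) + d0 ≤ ∑ k : Fin (n + 1), D k.1 := by
      rw [← Finset.add_sum_erase Finset.univ (fun k : Fin (n + 1) => D k.1) (Finset.mem_univ 0)]
      have e : ∑ j ∈ Finset.univ.erase (σ 0), C j (f j)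
          = ∑ k ∈ Finset.univ.erase (0 : Fin (n + 1)), C (σ k) (f (σ k)) := by
        symm
        apply Finset.sum_equiv σ
        · intro k; simp
        · intro k _; rfl
      rw [e]
      have h0 : D (0 : Fin (n + 1)).1 = ψ 0 := by simp [D]
      have := Finset.sum_le_sum (s := Finset.univ.erase (0 : Fin (n + 1)))
        (f := fun k => C (σ k) (f (σ k))) (g := fun k => D k.1)
        (fun k hk => hD k (Finset.ne_of_mem_erase hk))
      linarith
    refine hsum.trans ?_
    rw [Fin.sum_univ_eq_sum_range D (n + 1)]
    have h1 : ∀ t, t + 1 ≤ m → ∑ k ∈ Finset.range (t + 1), D k = ψ t := by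
      intro t
      induction t with
      | zero => intro _; simp [D]
      | succ t ih =>
        intro ht
        rw [Finset.sum_range_succ, ih (by omega)]
        have : t + 1 < m := by omega
        simp [D, this]
    have h2 : ∀ t, m ≤ t → t ≤ n + 1 → ∑ k ∈ Finset.range t, D k
        = ψ (m - 1) + ((if m < n + 1 then φ m else 0) - (if t < n + 1 then φ t else 0)) := by
      intro t hmt
      induction t, hmt using Nat.le_induction with
      | base =>
        intro _
        have := h1 (m - 1) (by omega)
        rw [Nat.sub_add_cancel hm1] at this
        rw [this]; ring
      | succ t hmt ih =>
        intro ht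
        rw [Finset.sum_range_succ, ih (by omega)]
        have a1 : t ≠ 0 := by omega
        have a2 : ¬ t < m := by omega
        have a3 : t < n + 1 := by omega
        simp only [D, if_neg a1, if_neg a2, if_pos a3]
        ring
    rw [h2 (n + 1) hmn le_rfl]
    have := hA (m - 1) (by omega)
    by_cases h : m < n + 1
    · have := hB m le_rfl h
      simp [h]; linarith
    · simp [h]; linarith

/-- Lower bound: each tree costs at least the cost of some cut. -/
lemma core_lower (P M : ℝ → ℝ) (hP : Monotone P) (hM : Monotone M)
    (ℓ : ℕ) (p : Fin ℓ → ℝ)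
    (hgap : ∀ v u, v ≤ u → (∀ (i : Fin ℓ) (k : ℤ), v < p i + k → p i + k < u → False) →
      ∃ y ∈ Icc v u, M y = M v ∧ P y = P u)
    (Vp Vm : ℝ → ℝ → ℝ)
    (hVp : ∀ (u v : ℝ) (k l : ℤ), u + k ≤ v + l → v + l < u + k + 1 → Vp u v = P (v + l) - P (u + k))
    (hVm : ∀ (u v : ℝ) (k l : ℤ), v + l ≤ u + k → u + k < v + l + 1 → Vm u v = M (u + k) - M (v + l))
    (x : ℝ) (i : Fin ℓ) (g : Fin ℓ → Fin ℓ) (hg : ∀ j, ∃ n, g^[n] j = i) :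
    ∃ y ∈ Icc x (x + 1), M y - M x + (P (x + 1) - P y) ≤
      (∑ j ∈ Finset.univ.erase i, min (Vp (p j) (p (g j))) (Vm (p j) (p (g j))))
        + min (Vp (p i) x) (Vm (p i) x) := by
  classical
  let κ : Fin ℓ → ℤ := fun j => -⌊p j - x⌋
  have hq1 : ∀ j, x ≤ p j + κ j := by
    intro j
    have := Int.floor_le (p j - x)
    simp only [κ]; push_cast; linarith
  have hq2 : ∀ j, p j + κ j < x + 1 := by
    intro j
    have := Int.lt_floor_add_one (p j - x)
    simp only [κ]; push_cast; linarith
  let t : Fin ℓ → ℝ := fun j => if j = i then x else p (g j)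
  let PP : Fin ℓ → ℝ := fun j => if Vp (p j) (t j) ≤ Vm (p j) (t j) then Vp (p j) (t j) else 0
  let NN : Fin ℓ → ℝ := fun j => if Vp (p j) (t j) ≤ Vm (p j) (t j) then 0 else Vm (p j) (t j)
  let φ : Fin ℓ → ℝ := fun j => P (x + 1) - P (p j + κ j)
  let ψ : Fin ℓ → ℝ := fun j => M (p j + κ j) - M x
  have hVp0 : ∀ u v, 0 ≤ Vp u v := by
    intro u v
    have h1 := Int.floor_le (v - u)
    have h2 := Int.lt_floor_add_one (v - u)
    have h3 : u + ((0 : ℤ) : ℝ) ≤ v + ((-⌊v - u⌋ : ℤ) : ℝ) := by push_cast; linarith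
    rw [hVp u v 0 (-⌊v - u⌋) h3 (by push_cast; linarith)]
    linarith [hP h3]
  have hVm0 : ∀ u v, 0 ≤ Vm u v := by
    intro u v
    have h1 := Int.floor_le (u - v)
    have h2 := Int.lt_floor_add_one (u - v)
    have h3 : v + ((0 : ℤ) : ℝ) ≤ u + ((-⌊u - v⌋ : ℤ) : ℝ) := by push_cast; linarith
    rw [hVm u v (-⌊u - v⌋) 0 h3 (by push_cast; linarith)]
    linarith [hM h3]
  have hPP : ∀ j, 0 ≤ PP j := by
    intro j; simp only [PP]; split_ifs
    · exact hVp0 _ _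
    · exact le_rfl
  have hNN : ∀ j, 0 ≤ NN j := by
    intro j; simp only [NN]; split_ifs
    · exact le_rfl
    · exact hVm0 _ _
  have hsum : (∑ j ∈ Finset.univ.erase i, min (Vp (p j) (p (g j))) (Vm (p j) (p (g j))))
        + min (Vp (p i) x) (Vm (p i) x) = ∑ j, PP j + ∑ j, NN j := by
    rw [← Finset.sum_add_distrib, ← Finset.add_sum_erase Finset.univ _ (Finset.mem_univ i),
      add_comm]
    have e : ∀ j, PP j + NN j = min (Vp (p j) (t j)) (Vm (p j) (t j)) := by
      intro j
      simp only [PP, NN]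
      split_ifs with h
      · rw [min_eq_left h, add_zero]
      · rw [min_eq_right (not_le.1 h).le, zero_add]
    congr 1
    · rw [e]; simp [t]
    · apply Finset.sum_congr rfl
      intro j hj
      rw [e]
      simp [t, Finset.ne_of_mem_erase hj]
  have hroot : φ i ≤ PP i ∨ ψ i ≤ NN i := by
    have ht : t i = x := by simp [t]
    have hx0 : x + ((0 : ℤ) : ℝ) = x := by simp
    have hx1 : x + ((1 : ℤ) : ℝ) = x + 1 := by simp
    by_cases hc : Vp (p i) (t i) ≤ Vm (p i) (t i)
    · rcases (hq1 i).eq_or_lt with h | h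
      · right
        have : ψ i = 0 := by simp only [ψ]; rw [← h]; ring
        rw [this]; exact hNN i
      · left
        simp only [PP, if_pos hc]
        rw [ht, hVp (p i) x (κ i) 1 (by rw [hx1]; exact (hq2 i).le) (by rw [hx1]; linarith), hx1]
    · right
      simp only [NN, if_neg hc]
      rw [ht, hVm (p i) x (κ i) 0 (by rw [hx0]; exact hq1 i) (by rw [hx0]; exact hq2 i), hx0]
  have hstep : ∀ j, j ≠ i → (φ j ≤ φ (g j) + PP j ∧ ψ j ≤ ψ (g j) + NN j) ∨
      φ j ≤ PP j ∨ ψ j ≤ NN j := by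
    intro j hj
    have ht : t j = p (g j) := by simp [t, hj]
    have a1 := hq1 j
    have a2 := hq2 j
    have b1 := hq1 (g j)
    have b2 := hq2 (g j)
    by_cases hc : Vp (p j) (t j) ≤ Vm (p j) (t j)
    · simp only [PP, NN, if_pos hc]
      rw [ht]
      by_cases h : p j + κ j ≤ p (g j) + κ (g j)
      · left
        rw [hVp _ _ (κ j) (κ (g j)) h (by linarith)]
        simp only [φ, ψ]
        constructor
        · linarith
        · linarith [hM h]
      · right; left
        push Not at h
        rw [hVp _ _ (κ j) (κ (g j) + 1) (by push_cast; linarith) (by push_cast; linarith)]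
        simp only [φ]
        have : P (x + 1) ≤ P (p (g j) + ((κ (g j) + 1 : ℤ) : ℝ)) :=
          hP (by push_cast; linarith)
        linarith
    · simp only [PP, NN, if_neg hc]
      rw [ht]
      by_cases h : p (g j) + κ (g j) ≤ p j + κ j
      · left
        rw [hVm _ _ (κ j) (κ (g j)) h (by linarith)]
        simp only [φ, ψ]
        constructor
        · linarith [hP h]
        · linarith
      · right; right
        push Not at h
        rw [hVm _ _ (κ j) (κ (g j) - 1) (by push_cast; linarith) (by push_cast; linarith)]
        simp only [ψ]
        have : M (p (g j) + ((κ (g j) - 1 : ℤ) : ℝ)) ≤ M x :=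
          hM (by push_cast; linarith)
        linarith
  have hcov := tree_cover g i hg PP NN φ ψ hPP hNN hstep hroot
  rw [hsum]
  have hSP : 0 ≤ ∑ j, PP j := Finset.sum_nonneg (fun j _ => hPP j)
  have hSN : 0 ≤ ∑ j, NN j := Finset.sum_nonneg (fun j _ => hNN j)
  generalize (∑ j, PP j) = SP at *
  generalize (∑ j, NN j) = SN at *
  -- leftmost point covered to the right
  obtain ⟨u, hu, humin⟩ := Finset.exists_min_image
    (insert (x + 1) ((Finset.univ.filter fun j => φ j ≤ SP).image fun j => p j + (κ j : ℝ)))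
    id ⟨x + 1, by simp⟩
  obtain ⟨v, hv, hvmax⟩ := Finset.exists_max_image
    (insert x ((Finset.univ.filter fun j => ¬ φ j ≤ SP).image fun j => p j + (κ j : ℝ)))
    id ⟨x, by simp⟩
  simp only [id] at humin hvmax
  have hu1 : P (x + 1) - P u ≤ SP ∧ x ≤ u ∧ u ≤ x + 1 := by
    simp only [Finset.mem_insert, Finset.mem_image, Finset.mem_filter, Finset.mem_univ,
      true_and] at hu
    rcases hu with rfl | ⟨j, hj, rfl⟩
    · exact ⟨by simpa using hSP, by linarith, le_rfl⟩
    · exact ⟨hj, hq1 j, (hq2 j).le⟩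
  have hv1 : M v - M x ≤ SN ∧ x ≤ v ∧ v ≤ x + 1 ∧ (v = x ∨ ¬ P (x + 1) - P v ≤ SP) := by
    simp only [Finset.mem_insert, Finset.mem_image, Finset.mem_filter, Finset.mem_univ,
      true_and] at hv
    rcases hv with rfl | ⟨j, hj, rfl⟩
    · exact ⟨by simpa using hSN, le_rfl, by linarith, Or.inl rfl⟩
    · exact ⟨(hcov j).resolve_left hj, hq1 j, (hq2 j).le, Or.inr hj⟩
  obtain ⟨hu1, hu2, hu3⟩ := hu1
  obtain ⟨hv1, hv2, hv3, hv4⟩ := hv1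
  by_cases hvu : u < v
  · exfalso
    rcases hv4 with rfl | h
    · linarith
    · exact h (by linarith [hP hvu.le])
  · push Not at hvu
    obtain ⟨y, hy, hy1, hy2⟩ := hgap v u hvu (by
      intro j k h1 h2
      have hk : k = κ j := by
        have c1 : ((k - κ j : ℤ) : ℝ) < 1 := by push_cast; linarith [hq1 j]
        have c2 : (-1 : ℝ) < ((k - κ j : ℤ) : ℝ) := by push_cast; linarith [hq2 j]
        have c1' : k - κ j < 1 := by exact_mod_cast c1
        have c2' : -1 < k - κ j := by exact_mod_cast c2
        omega
      subst hk
      by_cases hj : φ j ≤ SP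
      · have := humin (p j + κ j) (by
          simp only [Finset.mem_insert, Finset.mem_image, Finset.mem_filter, Finset.mem_univ,
            true_and]
          exact Or.inr ⟨j, hj, rfl⟩)
        linarith
      · have := hvmax (p j + κ j) (by
          simp only [Finset.mem_insert, Finset.mem_image, Finset.mem_filter, Finset.mem_univ,
            true_and]
          exact Or.inr ⟨j, hj, rfl⟩)
        linarith)
    exact ⟨y, ⟨hv2.trans hy.1, hy.2.trans hu3⟩, by rw [hy1, hy2]; linarith⟩

/-- Upper bound: each cut is realised by some tree. -/
lemma core_upper (P M : ℝ → ℝ) (hP : Monotone P) (hM : Monotone M) (P1 M1 : ℝ)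
    (hP1 : ∀ t, P (t + 1) = P t + P1) (hM1 : ∀ t, M (t + 1) = M t + M1)
    (n : ℕ) (p : Fin (n + 1) → ℝ) (hinj : ∀ i j (k l : ℤ), p i + k = p j + l → i = j)
    (hgap : ∀ v u, v ≤ u → (∀ (i : Fin (n + 1)) (k : ℤ), v < p i + k → p i + k < u → False) →
      ∃ y ∈ Icc v u, M y = M v ∧ P y = P u)
    (Vp Vm : ℝ → ℝ → ℝ)
    (hVp : ∀ (u v : ℝ) (k l : ℤ), u + k ≤ v + l → v + l < u + k + 1 → Vp u v = P (v + l) - P (u + k))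
    (hVm : ∀ (u v : ℝ) (k l : ℤ), v + l ≤ u + k → u + k < v + l + 1 → Vm u v = M (u + k) - M (v + l))
    (x y : ℝ) (hy : y ∈ Icc x (x + 1)) :
    ∃ (i : Fin (n + 1)) (g : Fin (n + 1) → Fin (n + 1)), (∀ j, ∃ N, g^[N] j = i) ∧
      (∑ j ∈ Finset.univ.erase i, min (Vp (p j) (p (g j))) (Vm (p j) (p (g j))))
        + min (Vp (p i) x) (Vm (p i) x) ≤ M y - M x + (P (x + 1) - P y) := by
  classical
  let κ : Fin (n + 1) → ℤ := fun j => -⌊p j - x⌋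
  have hq1 : ∀ j, x ≤ p j + κ j := by
    intro j
    have := Int.floor_le (p j - x)
    simp only [κ]; push_cast; linarith
  have hq2 : ∀ j, p j + κ j < x + 1 := by
    intro j
    have := Int.lt_floor_add_one (p j - x)
    simp only [κ]; push_cast; linarith
  let q : Fin (n + 1) → ℝ := fun j => p j + κ j
  let σ : Equiv.Perm (Fin (n + 1)) := Tuple.sort q
  have hmono : Monotone (q ∘ σ) := Tuple.monotone_sort q
  let r : ℕ → ℝ := fun k => q (σ ⟨min k n, by omega⟩)
  have hrk : ∀ k (hk : k < n + 1), r k = p (σ ⟨k, hk⟩) + κ (σ ⟨k, hk⟩) := by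
    intro k hk
    have : min k n = k := by omega
    simp only [r, q, this]
  have hrmono : Monotone r := by
    intro k l hkl
    apply hmono
    simp only [Fin.le_def]; omega
  have hr1 : ∀ k, x ≤ r k := fun k => hq1 _
  have hr2 : ∀ k, r k < x + 1 := fun k => hq2 _
  have hrlt : 1 ≤ n → r 0 < r n := by
    intro hn
    refine lt_of_le_of_ne (hrmono (Nat.zero_le _)) ?_
    intro h
    rw [hrk 0 (by omega), hrk n (by omega)] at h
    have := σ.injective (hinj _ _ _ _ h)
    simp only [Fin.mk.injEq] at this
    omega
  have hdich : P (r 0 + 1) = P (x + 1) ∨ M (x + 1) = M (r n) := by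
    obtain ⟨z, hz, hz1, hz2⟩ := hgap (r n) (r 0 + 1) (by linarith [hr2 n, hr1 0]) (by
      intro i k h1 h2
      have e0 : r 0 ≤ p i + κ i := by
        have : q (σ (σ.symm i)) = p i + κ i := by simp [q]
        rw [← this]
        have := hmono (Fin.zero_le (σ.symm i))
        simpa [r] using this
      have e1 : p i + κ i ≤ r n := by
        have : q (σ (σ.symm i)) = p i + κ i := by simp [q]
        rw [← this]
        apply hmono
        simp only [Fin.le_def]; omega
      have c1 : (0 : ℝ) < ((k - κ i : ℤ) : ℝ) := by push_cast; linarith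
      have c2 : ((k - κ i : ℤ) : ℝ) < 1 := by push_cast; linarith
      have c1' : 0 < k - κ i := by exact_mod_cast c1
      have c2' : k - κ i < 1 := by exact_mod_cast c2
      omega)
    by_cases h : z ≤ x + 1
    · left
      refine le_antisymm ?_ (hP (by linarith [hr1 0]))
      rw [← hz2]; exact hP h
    · right
      refine le_antisymm ?_ (hM (hr2 n).le)
      rw [← hz1]; exact hM (not_le.1 h).le
  obtain ⟨m, hmn, hmlt, hmge⟩ : ∃ m, m ≤ n + 1 ∧ (∀ k < m, r k ≤ y) ∧
      (∀ k, m ≤ k → k < n + 1 → y ≤ r k) := by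
    have hex : ∃ m, m = n + 1 ∨ y < r m := ⟨n + 1, Or.inl rfl⟩
    refine ⟨Nat.find hex, Nat.find_min' hex (Or.inl rfl), ?_, ?_⟩
    · intro k hk
      have := Nat.find_min hex hk
      push Not at this
      exact this.2
    · intro k hk hkn
      rcases Nat.find_spec hex with h | h
      · omega
      · exact h.le.trans (hrmono hk)
  have hA0 : 0 ≤ M y - M x := by linarith [hM hy.1]
  have hB0 : 0 ≤ P (x + 1) - P y := by linarith [hP hy.2]
  have hx0 : x + ((0 : ℤ) : ℝ) = x := by simp
  have hx1 : x + ((1 : ℤ) : ℝ) = x + 1 := by simp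
  have hcase : (1 ≤ m ∧ (m < n + 1 → P (r 0 + 1) = P (x + 1))) ∨
      (m ≤ n ∧ (1 ≤ m → M (x + 1) = M (r n))) := by
    rcases hdich with h | h
    · by_cases hm : 1 ≤ m
      · exact Or.inl ⟨hm, fun _ => h⟩
      · exact Or.inr ⟨by omega, fun h => absurd h hm⟩
    · by_cases hm : m ≤ n
      · exact Or.inr ⟨hm, fun _ => h⟩
      · exact Or.inl ⟨by omega, fun h => by omega⟩
  have hdownV : ∀ k (hk : k + 1 < n + 1),
      Vm (p (σ ⟨k + 1, hk⟩)) (p (σ ⟨k, by omega⟩)) = M (r (k + 1)) - M (r k) := by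
    intro k hk
    have e1 := hrk (k + 1) hk
    have e0 := hrk k (by omega)
    have hle := hrmono (Nat.le_succ k)
    rw [hVm _ _ (κ (σ ⟨k + 1, hk⟩)) (κ (σ ⟨k, by omega⟩))
      (by rw [← e1, ← e0]; exact hle)
      (by rw [← e1, ← e0]; linarith [hr1 k, hr2 (k + 1)]), ← e1, ← e0]
  have hupV : ∀ k (hk : k + 1 < n + 1),
      Vp (p (σ ⟨k, by omega⟩)) (p (σ ⟨k + 1, hk⟩)) = P (r (k + 1)) - P (r k) := by
    intro k hk
    have e1 := hrk (k + 1) hk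
    have e0 := hrk k (by omega)
    have hle := hrmono (Nat.le_succ k)
    rw [hVp _ _ (κ (σ ⟨k, by omega⟩)) (κ (σ ⟨k + 1, hk⟩))
      (by rw [← e1, ← e0]; exact hle)
      (by rw [← e1, ← e0]; linarith [hr1 k, hr2 (k + 1)]), ← e1, ← e0]
  have e0 := hrk 0 (by omega)
  have en := hrk n (by omega)
  rcases hcase with ⟨hm1, hw⟩ | ⟨hm1, hw⟩
  · obtain ⟨f, hf1, hf2⟩ := cut_tree n σ (fun a b => min (Vp (p a) (p b)) (Vm (p a) (p b)))
      (min (Vp (p (σ 0)) x) (Vm (p (σ 0)) x)) (fun k => M (r k) - M x)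
      (fun k => P (x + 1) - P (r k)) (M y - M x) (P (x + 1) - P y) m hm1 hmn
      (by
        refine (min_le_right _ _).trans ?_
        have e0' : r 0 = p (σ 0) + κ (σ 0) := e0
        rw [hVm (p (σ 0)) x (κ (σ 0)) 0 (by rw [hx0]; exact hq1 _) (by rw [hx0]; exact hq2 _),
          hx0, ← e0'])
      (by
        intro k hk
        refine (min_le_right _ _).trans ?_
        rw [hdownV k hk]; linarith)
      (by
        intro k hk
        refine (min_le_left _ _).trans ?_
        rw [hupV k hk]; linarith)
      (by
        intro h
        refine (min_le_left _ _).trans ?_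
        have e0' : r 0 = p (σ 0) + κ (σ 0) := e0
        have hlt := hrlt (by omega)
        have e0'' : p (σ 0) + ((κ (σ 0) + 1 : ℤ) : ℝ) = r 0 + 1 := by
          rw [e0']; push_cast; ring
        rw [hVp (p (σ ⟨n, by omega⟩)) (p (σ 0)) (κ (σ ⟨n, by omega⟩)) (κ (σ 0) + 1)
          (by rw [← en, e0'']; linarith [hr1 0, hr2 n]) (by rw [← en, e0'']; linarith),
          ← en, e0'', hw h])
      (by intro k hk; linarith [hM (hmlt k hk)])
      (by intro k hk hk2; linarith [hP (hmge k hk hk2)])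
      hB0
    exact ⟨σ 0, f, hf1, hf2⟩
  · let τ : Fin (n + 1) ≃ Fin (n + 1) := Fin.revPerm.trans σ
    have hτ : ∀ k (hk : k < n + 1), τ ⟨k, hk⟩ = σ ⟨n - k, by omega⟩ := by
      intro k hk
      simp only [τ, Equiv.trans_apply, Fin.revPerm_apply]
      congr 1
      apply Fin.ext
      simp only [Fin.val_rev]; omega
    have hτ0 : τ 0 = σ ⟨n, by omega⟩ := hτ 0 (by omega)
    have hτn : τ ⟨n, by omega⟩ = σ 0 := by
      rw [hτ n (by omega)]; congr 1; apply Fin.ext; simp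
    obtain ⟨f, hf1, hf2⟩ := cut_tree n τ (fun a b => min (Vp (p a) (p b)) (Vm (p a) (p b)))
      (min (Vp (p (τ 0)) x) (Vm (p (τ 0)) x)) (fun k => P (x + 1) - P (r (n - k)))
      (fun k => M (r (n - k)) - M x) (P (x + 1) - P y) (M y - M x) (n + 1 - m) (by omega) (by omega)
      (by
        refine (min_le_left _ _).trans ?_
        rw [hτ0, Nat.sub_zero]
        rcases (hr1 n).eq_or_lt with h | h
        · rw [hVp (p (σ ⟨n, by omega⟩)) x (κ (σ ⟨n, by omega⟩)) 0
            (by rw [← en, hx0]; exact h.ge) (by rw [← en, hx0]; linarith), hx0, ← en]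
          linarith [hP (show x ≤ x + 1 by linarith)]
        · rw [hVp (p (σ ⟨n, by omega⟩)) x (κ (σ ⟨n, by omega⟩)) 1
            (by rw [← en, hx1]; exact (hr2 n).le) (by rw [← en, hx1]; linarith), hx1, ← en])
      (by
        intro k hk
        refine (min_le_left _ _).trans ?_
        obtain ⟨j, hj⟩ : ∃ j, n - k = j + 1 := ⟨n - k - 1, by omega⟩
        have hj' : n - (k + 1) = j := by omega
        have hjn : j + 1 < n + 1 := by omega
        have t1 : τ ⟨k + 1, hk⟩ = σ ⟨j, by omega⟩ := by
          rw [hτ]; simp only [hj']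
        have t2 : τ ⟨k, by omega⟩ = σ ⟨j + 1, hjn⟩ := by
          rw [hτ]; simp only [hj]
        rw [t1, t2, hupV j hjn, hj, hj']; linarith)
      (by
        intro k hk
        refine (min_le_right _ _).trans ?_
        obtain ⟨j, hj⟩ : ∃ j, n - k = j + 1 := ⟨n - k - 1, by omega⟩
        have hj' : n - (k + 1) = j := by omega
        have hjn : j + 1 < n + 1 := by omega
        have t1 : τ ⟨k + 1, hk⟩ = σ ⟨j, by omega⟩ := by
          rw [hτ]; simp only [hj']
        have t2 : τ ⟨k, by omega⟩ = σ ⟨j + 1, hjn⟩ := by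
          rw [hτ]; simp only [hj]
        rw [t1, t2, hdownV j hjn, hj, hj']; linarith)
      (by
        intro h
        refine (min_le_right _ _).trans ?_
        rw [hτ0, hτn, Nat.sub_self]
        have e0' : r 0 = p (σ 0) + κ (σ 0) := e0
        have hlt := hrlt (by omega)
        have en' : p (σ ⟨n, by omega⟩) + ((κ (σ ⟨n, by omega⟩) - 1 : ℤ) : ℝ) = r n - 1 := by
          rw [en]; push_cast; ring
        rw [hVm (p (σ 0)) (p (σ ⟨n, by omega⟩)) (κ (σ 0)) (κ (σ ⟨n, by omega⟩) - 1)
          (by rw [← e0', en']; linarith [hr1 0, hr2 n]) (by rw [← e0', en']; linarith),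
          ← e0', en']
        have h3 := hw (by omega)
        have h4 := hM1 (r n - 1)
        have h5 := hM1 x
        rw [sub_add_cancel] at h4
        linarith)
      (by intro k hk; linarith [hP (hmge (n - k) (by omega) (by omega))])
      (by intro k hk hk2; linarith [hM (hmlt (n - k) (by omega))])
      hA0
    refine ⟨τ 0, f, hf1, ?_⟩
    linarith

lemma ordConnected_ev_right (C : Set ℝ) (hC : C.OrdConnected) (z : ℝ) :
    (∀ᶠ t in 𝓝[>] z, t ∈ C) ∨ (∀ᶠ t in 𝓝[>] z, t ∉ C) := by
  by_cases h : ∃ᶠ t in 𝓝[>] z, t ∈ C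
  · left
    obtain ⟨c, hc, hcz⟩ := (h.and_eventually self_mem_nhdsWithin).exists
    filter_upwards [Ioo_mem_nhdsGT hcz] with t ht
    obtain ⟨c', hc', hcz'⟩ := (h.and_eventually (Ioo_mem_nhdsGT ht.1)).exists
    exact hC.out hc' hc ⟨hcz'.2.le, ht.2.le⟩
  · right; exact not_frequently.1 h

lemma ordConnected_ev_left (C : Set ℝ) (hC : C.OrdConnected) (z : ℝ) :
    (∀ᶠ t in 𝓝[<] z, t ∈ C) ∨ (∀ᶠ t in 𝓝[<] z, t ∉ C) := by
  by_cases h : ∃ᶠ t in 𝓝[<] z, t ∈ C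
  · left
    obtain ⟨c, hc, hcz⟩ := (h.and_eventually self_mem_nhdsWithin).exists
    filter_upwards [Ioo_mem_nhdsLT hcz] with t ht
    obtain ⟨c', hc', hcz'⟩ := (h.and_eventually (Ioo_mem_nhdsLT ht.2)).exists
    exact hC.out hc hc' ⟨ht.1.le, hcz'.1.le⟩
  · right; exact not_frequently.1 h

lemma finite_comp_ev (Z : Set ℝ) (hfin : Finite (ConnectedComponents Z)) (l : Filter ℝ)
    (hl : ∀ C : Set ℝ, C.OrdConnected → (∀ᶠ t in l, t ∈ C) ∨ (∀ᶠ t in l, t ∉ C)) :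
    (∀ᶠ t in l, t ∈ Z) ∨ (∀ᶠ t in l, t ∉ Z) := by
  let C : ConnectedComponents Z → Set ℝ := fun c =>
    Subtype.val '' ((ConnectedComponents.mk : Z → ConnectedComponents Z) ⁻¹' {c})
  have hC : ∀ c, (C c).OrdConnected := by
    intro c
    obtain ⟨w, rfl⟩ := ConnectedComponents.surjective_coe c
    apply IsPreconnected.ordConnected
    apply IsPreconnected.image
    · rw [connectedComponents_preimage_singleton]
      exact isPreconnected_connectedComponent
    · exact continuous_subtype_val.continuousOn
  by_cases h : ∃ c, ∀ᶠ t in l, t ∈ C c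
  · left
    obtain ⟨c, hc⟩ := h
    filter_upwards [hc] with t ht
    obtain ⟨w, _, rfl⟩ := ht
    exact w.2
  · right
    have h2 : ∀ c, ∀ᶠ t in l, t ∉ C c := by
      intro c
      rcases hl (C c) (hC c) with h3 | h3
      · exact absurd h3 (not_exists.1 h c)
      · exact h3
    filter_upwards [eventually_all.2 h2] with t ht htZ
    exact ht (ConnectedComponents.mk ⟨t, htZ⟩) ⟨⟨t, htZ⟩, rfl, rfl⟩

lemma per_int (F : ℝ → ℝ) (hFper : ∀ x, F (x + 1) = F x) (k : ℤ) (x : ℝ) : F (x - k) = F x := by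
  have h : Function.Periodic F 1 := hFper
  simpa using h.sub_int_mul_eq k (x := x)

lemma ev_right (F : ℝ → ℝ) (hFper : ∀ x, F (x + 1) = F x)
    (hfin : Finite (ConnectedComponents {x : ℝ | F x = 0 ∧ x ∈ Icc (0:ℝ) 1})) (z : ℝ) :
    (∀ᶠ t in 𝓝[>] z, F t = 0) ∨ (∀ᶠ t in 𝓝[>] z, F t ≠ 0) := by
  have hz0 := Int.floor_le z
  have hz1 := Int.lt_floor_add_one z
  have key := finite_comp_ev _ hfin (𝓝[>] (z - ⌊z⌋)) (fun C hC => ordConnected_ev_right C hC _)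
  have ht : Tendsto (fun t : ℝ => t - ⌊z⌋) (𝓝[>] z) (𝓝[>] (z - ⌊z⌋)) := by
    apply tendsto_nhdsWithin_of_tendsto_nhds_of_eventually_within
    · exact ((continuous_id.sub continuous_const).tendsto z).mono_left nhdsWithin_le_nhds
    · filter_upwards [self_mem_nhdsWithin] with t ht
      simp only [mem_Ioi] at ht ⊢; linarith
  rcases key with h | h
  · left
    filter_upwards [ht.eventually h] with t h2
    rw [← per_int F hFper ⌊z⌋ t]; exact h2.1
  · right
    filter_upwards [ht.eventually h, Ioo_mem_nhdsGT hz1] with t h2 h3 h4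
    refine h2 ⟨by rw [per_int F hFper]; exact h4, ?_, ?_⟩
    · linarith [h3.1]
    · linarith [h3.2]

lemma ev_left (F : ℝ → ℝ) (hFper : ∀ x, F (x + 1) = F x)
    (hfin : Finite (ConnectedComponents {x : ℝ | F x = 0 ∧ x ∈ Icc (0:ℝ) 1})) (z : ℝ) :
    (∀ᶠ t in 𝓝[<] z, F t = 0) ∨ (∀ᶠ t in 𝓝[<] z, F t ≠ 0) := by
  have hz0 := Int.le_ceil z
  have hz1 := Int.ceil_lt_add_one z
  set k : ℤ := ⌈z⌉ - 1 with hk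
  have hk1 : (k : ℝ) < z := by rw [hk]; push_cast; linarith
  have hk2 : z ≤ k + 1 := by rw [hk]; push_cast; linarith
  have key := finite_comp_ev _ hfin (𝓝[<] (z - k)) (fun C hC => ordConnected_ev_left C hC _)
  have ht : Tendsto (fun t : ℝ => t - k) (𝓝[<] z) (𝓝[<] (z - k)) := by
    apply tendsto_nhdsWithin_of_tendsto_nhds_of_eventually_within
    · exact ((continuous_id.sub continuous_const).tendsto z).mono_left nhdsWithin_le_nhds
    · filter_upwards [self_mem_nhdsWithin] with t ht
      simp only [mem_Iio] at ht ⊢; linarith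
  rcases key with h | h
  · left
    filter_upwards [ht.eventually h] with t h2
    rw [← per_int F hFper k t]; exact h2.1
  · right
    filter_upwards [ht.eventually h, Ioo_mem_nhdsLT hk1] with t h2 h3 h4
    refine h2 ⟨by rw [per_int F hFper]; exact h4, ?_, ?_⟩
    · linarith [h3.1]
    · linarith [h3.2]

lemma same_sign (F : ℝ → ℝ) (hF : Continuous F) (c d u w : ℝ) (h : ∀ t ∈ Ioo c d, F t ≠ 0)
    (hu : u ∈ Ioo c d) (hw : w ∈ Ioo c d) (h1 : 0 < F u) : 0 < F w := by
  by_contra h2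
  push Not at h2
  have h0 : (0 : ℝ) ∈ uIcc (F u) (F w) := by
    rw [mem_uIcc]; right; exact ⟨h2, h1.le⟩
  obtain ⟨t, ht, ht0⟩ := intermediate_value_uIcc (f := F) hF.continuousOn h0
  exact h t (ordConnected_Ioo.uIcc_subset hu hw ht) ht0

lemma exists_stable (F : ℝ → ℝ) (hF : Continuous F) (hFper : ∀ x, F (x + 1) = F x)
    (hfin : Finite (ConnectedComponents {x : ℝ | F x = 0 ∧ x ∈ Icc (0:ℝ) 1}))
    (s t : ℝ) (hst : s < t) (hs : F s < 0) (ht : 0 < F t) :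
    ∃ a' b', s < a' ∧ a' ≤ b' ∧ b' < t ∧ (∀ x ∈ Icc a' b', F x = 0) ∧
      (∃ ε > 0, (∀ x ∈ Ico (a' - ε) a', F x < 0) ∧ (∀ x ∈ Ioc b' (b' + ε), 0 < F x)) := by
  -- right end point
  let B : Set ℝ := {u | u ∈ Icc s t ∧ 0 < F u}
  have hBne : B.Nonempty := ⟨t, ⟨hst.le, le_rfl⟩, ht⟩
  have hBbd : BddBelow B := ⟨s, fun u hu => hu.1.1⟩
  set b' := sInf B with hb'
  have hsb : s ≤ b' := le_csInf hBne (fun u hu => hu.1.1)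
  have hbt : b' ≤ t := csInf_le hBbd ⟨⟨hst.le, le_rfl⟩, ht⟩
  have hneg : ∀ u ∈ Ico s b', F u ≤ 0 := by
    intro u hu
    by_contra h
    push Not at h
    have : b' ≤ u := csInf_le hBbd ⟨⟨hu.1, hu.2.le.trans hbt⟩, h⟩
    linarith [hu.2]
  have hb0 : 0 ≤ F b' := by
    have h1 : b' ∈ closure B := csInf_mem_closure hBne hBbd
    have h2 : closure B ⊆ {u | 0 ≤ F u} :=
      closure_minimal (fun u hu => hu.2.le) (isClosed_le continuous_const hF)
    exact h2 h1
  have hsb' : s < b' := by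
    refine lt_of_le_of_ne hsb ?_
    intro h
    rw [← h] at hb0; linarith
  have hb1 : F b' ≤ 0 := by
    have h1 : b' ∈ closure (Ico s b') := by rw [closure_Ico hsb'.ne]; exact ⟨hsb, le_rfl⟩
    have h2 : closure (Ico s b') ⊆ {u | F u ≤ 0} :=
      closure_minimal hneg (isClosed_le hF continuous_const)
    exact h2 h1
  have hb : F b' = 0 := le_antisymm hb1 hb0
  have hbt' : b' < t := by
    refine lt_of_le_of_ne hbt ?_
    intro h
    rw [h] at hb; linarith
  -- left end point
  let A : Set ℝ := {u | u ∈ Icc s b' ∧ F u < 0}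
  have hAne : A.Nonempty := ⟨s, ⟨le_rfl, hsb⟩, hs⟩
  have hAbd : BddAbove A := ⟨b', fun u hu => hu.1.2⟩
  set a' := sSup A with ha'
  have hsa : s ≤ a' := le_csSup hAbd ⟨⟨le_rfl, hsb⟩, hs⟩
  have hab : a' ≤ b' := csSup_le hAne (fun u hu => hu.1.2)
  have hpos : ∀ u ∈ Ioc a' b', 0 ≤ F u := by
    intro u hu
    by_contra h
    push Not at h
    have : u ≤ a' := le_csSup hAbd ⟨⟨hsa.trans hu.1.le, hu.2⟩, h⟩
    linarith [hu.1]
  have ha0 : F a' ≤ 0 := by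
    have h1 : a' ∈ closure A := csSup_mem_closure hAne hAbd
    have h2 : closure A ⊆ {u | F u ≤ 0} :=
      closure_minimal (fun u hu => hu.2.le) (isClosed_le hF continuous_const)
    exact h2 h1
  have ha1 : 0 ≤ F a' := by
    rcases hab.eq_or_lt with h | h
    · rw [h]; exact hb0
    · have h1 : a' ∈ closure (Ioc a' b') := by rw [closure_Ioc h.ne]; exact ⟨le_rfl, hab⟩
      have h2 : closure (Ioc a' b') ⊆ {u | 0 ≤ F u} :=
        closure_minimal hpos (isClosed_le continuous_const hF)
      exact h2 h1
  have ha : F a' = 0 := le_antisymm ha0 ha1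
  have hsa' : s < a' := by
    refine lt_of_le_of_ne hsa ?_
    intro h
    rw [← h] at ha; linarith
  have hzero : ∀ x ∈ Icc a' b', F x = 0 := by
    intro x hx
    rcases hx.1.eq_or_lt with h | h
    · rw [← h]; exact ha
    · rcases hx.2.eq_or_lt with h' | h'
      · rw [h']; exact hb
      · exact le_antisymm (hneg x ⟨hsa.trans hx.1, h'⟩) (hpos x ⟨h, hx.2⟩)
  -- positivity on the right
  have hfreqR : ∃ᶠ u in 𝓝[>] b', 0 < F u := by
    rw [Filter.frequently_iff]
    intro U hU
    obtain ⟨d, hd, hdU⟩ := mem_nhdsGT_iff_exists_Ioo_subset.1 hU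
    obtain ⟨u, hu, hud⟩ := exists_lt_of_csInf_lt hBne (show sInf B < d from hd)
    have hbu : b' ≤ u := csInf_le hBbd hu
    have hbu' : b' ≠ u := by
      intro h; have := hu.2; rw [← h] at this; linarith
    exact ⟨u, hdU ⟨lt_of_le_of_ne hbu hbu', hud⟩, hu.2⟩
  have hevR : ∀ᶠ u in 𝓝[>] b', F u ≠ 0 := by
    rcases ev_right F hFper hfin b' with h | h
    · obtain ⟨u, h1, h2⟩ := (hfreqR.and_eventually h).exists
      linarith
    · exact h
  obtain ⟨d, hd, hdU⟩ := mem_nhdsGT_iff_exists_Ioo_subset.1 hevR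
  obtain ⟨u0, hu0, hu0d⟩ := (hfreqR.and_eventually (Ioo_mem_nhdsGT hd)).exists
  have hR : ∀ w ∈ Ioo b' d, 0 < F w := fun w hw =>
    same_sign F hF b' d u0 w (fun t ht => hdU ht) hu0d hw hu0
  -- negativity on the left
  have hfreqL : ∃ᶠ u in 𝓝[<] a', F u < 0 := by
    rw [Filter.frequently_iff]
    intro U hU
    obtain ⟨c, hc, hcU⟩ := mem_nhdsLT_iff_exists_Ioo_subset.1 hU
    obtain ⟨u, hu, hud⟩ := exists_lt_of_lt_csSup hAne (show c < sSup A from hc)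
    have hbu : u ≤ a' := le_csSup hAbd hu
    have hbu' : u ≠ a' := by
      intro h; have := hu.2; rw [h] at this; linarith
    exact ⟨u, hcU ⟨hud, lt_of_le_of_ne hbu hbu'⟩, hu.2⟩
  have hevL : ∀ᶠ u in 𝓝[<] a', F u ≠ 0 := by
    rcases ev_left F hFper hfin a' with h | h
    · obtain ⟨u, h1, h2⟩ := (hfreqL.and_eventually h).exists
      linarith
    · exact h
  obtain ⟨c, hc, hcU⟩ := mem_nhdsLT_iff_exists_Ioo_subset.1 hevL
  obtain ⟨v0, hv0, hv0c⟩ := (hfreqL.and_eventually (Ioo_mem_nhdsLT hc)).exists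
  have hL : ∀ w ∈ Ioo c a', F w < 0 := by
    intro w hw
    have := same_sign (fun t => - F t) hF.neg c a' v0 w
      (fun t ht => neg_ne_zero.2 (hcU ht)) hv0c hw (by simpa using hv0)
    simpa using this
  have hd' : b' < d := hd
  have hc' : c < a' := hc
  refine ⟨a', b', hsa', hab, hbt', hzero, min ((d - b') / 2) ((a' - c) / 2),
    lt_min (by linarith) (by linarith), ?_, ?_⟩
  · intro x hx
    have := min_le_right ((d - b') / 2) ((a' - c) / 2)
    exact hL x ⟨by linarith [hx.1], hx.2⟩
  · intro x hx
    have := min_le_left ((d - b') / 2) ((a' - c) / 2)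
    exact hR x ⟨hx.1, by linarith [hx.2]⟩

lemma gap_point (F : ℝ → ℝ) (hF : Continuous F) (v u : ℝ) (hvu : v ≤ u)
    (h : ∀ s t, v < s → s < t → t < u → F s < 0 → 0 < F t → False) :
    ∃ y ∈ Icc v u, (∫ s in (0:ℝ)..y, max (-F s) 0) = (∫ s in (0:ℝ)..v, max (-F s) 0) ∧
      (∫ s in (0:ℝ)..y, max (F s) 0) = (∫ s in (0:ℝ)..u, max (F s) 0) := by
  have hFp : Continuous fun s => max (F s) 0 := hF.max continuous_const
  have hFm : Continuous fun s => max (-F s) 0 := hF.neg.max continuous_const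
  let B : Set ℝ := insert v {t | t ∈ Ioo v u ∧ 0 < F t}
  have hBne : B.Nonempty := ⟨v, mem_insert _ _⟩
  have hBle : ∀ t ∈ B, t ≤ u := by
    rintro t (rfl | ht)
    · exact hvu
    · exact ht.1.2.le
  have hBbd : BddAbove B := ⟨u, hBle⟩
  set y := sSup B with hy
  have hvy : v ≤ y := le_csSup hBbd (mem_insert _ _)
  have hyu : y ≤ u := csSup_le hBne hBle
  have h1 : ∀ t ∈ Ioo v y, 0 ≤ F t := by
    intro t ht
    by_contra hn
    push Not at hn
    obtain ⟨w, hw, htw⟩ := exists_lt_of_lt_csSup hBne (show t < sSup B from ht.2)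
    rcases hw with rfl | hw
    · linarith [ht.1]
    · exact h t w ht.1 htw hw.1.2 hn hw.2
  have h2 : ∀ t ∈ Ioo y u, F t ≤ 0 := by
    intro t ht
    by_contra hn
    push Not at hn
    have : t ≤ y := le_csSup hBbd (mem_insert_of_mem _ ⟨⟨lt_of_le_of_lt hvy ht.1, ht.2⟩, hn⟩)
    linarith [ht.1]
  have zero_int : ∀ (G : ℝ → ℝ) (c d : ℝ), Continuous G → c ≤ d → (∀ t ∈ Ioo c d, G t = 0) →
      ∫ s in c..d, G s = 0 := by
    intro G c d hG hcd hz
    rcases hcd.eq_or_lt with rfl | hcd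
    · simp
    · have hz' : ∀ t ∈ Icc c d, G t = 0 := by
        rw [← closure_Ioo hcd.ne]
        exact closure_minimal hz (isClosed_eq hG continuous_const)
      rw [intervalIntegral.integral_congr (g := fun _ => (0:ℝ))]
      · simp
      · intro t ht
        rw [uIcc_of_le hcd.le] at ht
        exact hz' t ht
  refine ⟨y, ⟨hvy, hyu⟩, ?_, ?_⟩
  · have := intervalIntegral.integral_add_adjacent_intervals
      (hFm.intervalIntegrable 0 v) (hFm.intervalIntegrable (μ := MeasureTheory.volume) v y)
    rw [zero_int _ v y hFm hvy (fun t ht => by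
      simp only [max_eq_right_iff]; linarith [h1 t ht])] at this
    linarith
  · have := intervalIntegral.integral_add_adjacent_intervals
      (hFp.intervalIntegrable 0 y) (hFp.intervalIntegrable (μ := MeasureTheory.volume) y u)
    rw [zero_int _ y u hFp hyu (fun t ht => by
      simp only [max_eq_right_iff]; exact h2 t ht)] at this
    linarith


lemma prim_facts (G : ℝ → ℝ) (hG : Continuous G) (hG0 : ∀ x, 0 ≤ G x)
    (hper : ∀ x, G (x + 1) = G x) (Q : ℝ → ℝ) (hQ : ∀ t, Q t = ∫ s in (0:ℝ)..t, G s) :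
    Monotone Q ∧ (∀ t, Q (t + 1) = Q t + Q 1) ∧
    (∀ (u v : ℝ) (k l : ℤ), u + k ≤ v + l → v + l < u + k + 1 →
      ∫ s in u..(u + Int.fract (v - u)), G s = Q (v + l) - Q (u + k)) := by
  have hintv : ∀ a b, IntervalIntegrable G MeasureTheory.volume a b :=
    fun a b => hG.intervalIntegrable a b
  have hdiff : ∀ a b, ∫ s in a..b, G s = Q b - Q a := by
    intro a b
    rw [hQ, hQ]
    have := intervalIntegral.integral_add_adjacent_intervals (hintv 0 a) (hintv a b)
    linarith
  have h1 : ∀ t, Q (t + 1) = Q t + Q 1 := by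
    intro t
    have hp : Function.Periodic G 1 := hper
    have := hp.intervalIntegral_add_eq t 0
    rw [hdiff, hdiff] at this
    have h0 : Q 0 = 0 := by rw [hQ]; simp
    rw [zero_add, h0] at this
    linarith
  refine ⟨?_, h1, ?_⟩
  · intro a b hab
    have := intervalIntegral.integral_nonneg (μ := MeasureTheory.volume) hab (fun s _ => hG0 s)
    rw [hdiff] at this
    linarith
  · intro u v k l h2 h3
    have hfr : Int.fract (v - u) = v + l - (u + k) := by
      rw [Int.fract_eq_iff]
      refine ⟨by linarith, by linarith, k - l, ?_⟩
      push_cast; ring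
    have hshift := per_int (fun t => Q t - t * Q 1)
      (fun t => by rw [h1]; ring) k
    have e1 := hshift (v + l)
    have e2 := hshift (u + k)
    simp only [add_sub_cancel_right] at e1 e2
    rw [hdiff, hfr]
    have e3 : u + (v + l - (u + k)) = v + l - (k : ℝ) := by ring
    rw [e3]
    linarith



/-- Theorem `ruspa` (ii): the geometric transform
`Φ(x) = min_{y∈[x,x+1]} (S(x) − S(y))` of `S` and the Freidlin–Wentzell
quasipotential `W` coincide up to an additive constant:
`Φ(x) − min_{[0,1]} Φ = W(π(x)) − min_𝕋 W` for every `x ∈ ℝ` (here both `Φ` and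
`W` are viewed as 1-periodic functions on `ℝ`, so the minima over the torus are
infima over `[0,1]`).

Setting: `F` continuous and 1-periodic, `S(x) = ∫₀ˣ F`, zero set of `F` on the
torus with finitely many connected components; the stable components
`K_i = [a i, b i] ⊆ [0,1)` are listed in clockwise order with representatives
`p i`, exhaustively. Arc integrals `V₊, V₋` are realized by lifting the second
endpoint via `Int.fract`, `V = min(V₊,V₋)`; directed trees rooted at `i` and
oriented towards the root are encoded as maps `f : Fin ℓ → Fin ℓ` with every
vertex reaching `i` under iteration; `W(K_i)` is the minimum over such trees of
`Σ_{j≠i} V(K_j,K_{f j})` and `W(x) = min_i (W(K_i) + V(K_i,x))` (for `ℓ = 0`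
both infima over the empty family equal `0` by convention, matching `W ≡ 0`). -/
theorem stmt_19
    (F : ℝ → ℝ) (hF : Continuous F) (hFper : ∀ x, F (x + 1) = F x)
    (S : ℝ → ℝ) (hS : ∀ x, S x = ∫ t in (0:ℝ)..x, F t)
    (Φ : ℝ → ℝ) (hΦ : ∀ x, Φ x = sInf ((fun y => S x - S y) '' Icc x (x + 1)))
    (hfin : Finite (ConnectedComponents {x : ℝ | F x = 0 ∧ x ∈ Icc (0:ℝ) 1}))
    (ℓ : ℕ) (a b p : Fin ℓ → ℝ)
    (hrange : ∀ i, 0 ≤ a i ∧ a i ≤ b i ∧ b i < 1)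
    (hord : ∀ i j : Fin ℓ, i < j → b i < a j)
    (hp : ∀ i, p i ∈ Icc (a i) (b i))
    (hstable : ∀ i, (∀ x ∈ Icc (a i) (b i), F x = 0) ∧
      ∃ ε > 0, (∀ x ∈ Ico (a i - ε) (a i), F x < 0) ∧
        (∀ x ∈ Ioc (b i) (b i + ε), 0 < F x))
    (hexh : ∀ a' b' : ℝ, a' ≤ b' → (∀ x ∈ Icc a' b', F x = 0) →
      (∃ ε > 0, (∀ x ∈ Ico (a' - ε) a', F x < 0) ∧
        (∀ x ∈ Ioc b' (b' + ε), 0 < F x)) →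
      ∃ (i : Fin ℓ) (k : ℤ), a' = a i + k ∧ b' = b i + k)
    (Vp Vm : ℝ → ℝ → ℝ)
    (hVp : ∀ u v, Vp u v = ∫ s in u..(u + Int.fract (v - u)), max (F s) 0)
    (hVm : ∀ u v, Vm u v = ∫ s in v..(v + Int.fract (u - v)), max (-F s) 0)
    (WK : Fin ℓ → ℝ)
    (hWK : ∀ i, WK i = ⨅ g : {f : Fin ℓ → Fin ℓ // ∀ j, ∃ n, f^[n] j = i},
      ∑ j ∈ Finset.univ.erase i, min (Vp (p j) (p (g.1 j))) (Vm (p j) (p (g.1 j))))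
    (W : ℝ → ℝ)
    (hW : ∀ x, W x = ⨅ i : Fin ℓ, (WK i + min (Vp (p i) x) (Vm (p i) x))) :
    ∀ x : ℝ, Φ x - sInf (Φ '' Icc (0:ℝ) 1) = W x - sInf (W '' Icc (0:ℝ) 1) := by
  have hFp : Continuous fun s => max (F s) 0 := hF.max continuous_const
  have hFm : Continuous fun s => max (-F s) 0 := hF.neg.max continuous_const
  obtain ⟨P, hPdef⟩ : ∃ P : ℝ → ℝ, ∀ t, P t = ∫ s in (0:ℝ)..t, max (F s) 0 := ⟨_, fun _ => rfl⟩
  obtain ⟨M, hMdef⟩ : ∃ M : ℝ → ℝ, ∀ t, M t = ∫ s in (0:ℝ)..t, max (-F s) 0 := ⟨_, fun _ => rfl⟩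
  obtain ⟨hPm, hP1, hPV⟩ := prim_facts _ hFp (fun x => le_max_right _ _)
    (fun x => by simp only [hFper]) P hPdef
  obtain ⟨hMm, hM1, hMV⟩ := prim_facts _ hFm (fun x => le_max_right _ _)
    (fun x => by simp only [hFper]) M hMdef
  have hVp' : ∀ (u v : ℝ) (k l : ℤ), u + k ≤ v + l → v + l < u + k + 1 →
      Vp u v = P (v + l) - P (u + k) := by
    intro u v k l h1 h2
    rw [hVp]; exact hPV u v k l h1 h2
  have hVm' : ∀ (u v : ℝ) (k l : ℤ), v + l ≤ u + k → u + k < v + l + 1 →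
      Vm u v = M (u + k) - M (v + l) := by
    intro u v k l h1 h2
    rw [hVm]; exact hMV v u l k h1 h2
  have hSPM : ∀ t, S t = P t - M t := by
    intro t
    rw [hS, hPdef, hMdef, ← intervalIntegral.integral_sub (hFp.intervalIntegrable _ _)
      (hFm.intervalIntegrable _ _)]
    apply intervalIntegral.integral_congr
    intro s _
    simp only
    rcases le_total (F s) 0 with h | h
    · rw [max_eq_right h, max_eq_left (by linarith)]; ring
    · rw [max_eq_left h, max_eq_right (by linarith)]; ring
  have hgap : ∀ v u, v ≤ u → (∀ (i : Fin ℓ) (k : ℤ), v < p i + k → p i + k < u → False) →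
      ∃ y ∈ Icc v u, M y = M v ∧ P y = P u := by
    intro v u hvu hno
    simp only [hPdef, hMdef]
    apply gap_point F hF v u hvu
    intro s t hvs hst htu hs ht
    obtain ⟨a', b', h1, h2, h3, h4, h5⟩ := exists_stable F hF hFper hfin s t hst hs ht
    obtain ⟨i, k, ha, hb⟩ := hexh a' b' h2 h4 h5
    have := hp i
    exact hno i k (by linarith [this.1]) (by linarith [this.2])
  have hlt : ∀ i j : Fin ℓ, i < j → p i < p j := by
    intro i j hij
    linarith [hord i j hij, (hp i).2, (hp j).1]
  have hinj : ∀ (i j : Fin ℓ) (k l : ℤ), p i + k = p j + l → i = j := by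
    intro i j k l h
    have i1 := hrange i
    have j1 := hrange j
    have i2 := hp i
    have j2 := hp j
    have c1 : ((k - l : ℤ) : ℝ) < 1 := by push_cast; linarith [i2.1, j2.2]
    have c2 : (-1 : ℝ) < ((k - l : ℤ) : ℝ) := by push_cast; linarith [i2.2, j2.1]
    have c1' : k - l < 1 := by exact_mod_cast c1
    have c2' : -1 < k - l := by exact_mod_cast c2
    have hkl : k = l := by omega
    subst hkl
    rcases lt_trichotomy i j with h' | h' | h'
    · linarith [hlt i j h']
    · exact h'
    · linarith [hlt j i h']
  -- the two bounds
  have hmain : ∀ x, (∀ y ∈ Icc x (x + 1), W x ≤ M y - M x + (P (x + 1) - P y)) ∧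
      ∃ y ∈ Icc x (x + 1), M y - M x + (P (x + 1) - P y) ≤ W x := by
    intro x
    rcases ℓ with _ | n
    · have hW0 : W x = 0 := by rw [hW]; exact Real.iInf_of_isEmpty _
      rw [hW0]
      constructor
      · intro y hy
        linarith [hMm hy.1, hPm hy.2]
      · obtain ⟨y, hy, hy1, hy2⟩ := hgap x (x + 2) (by linarith) (fun i => i.elim0)
        by_cases h : x + 1 ≤ y
        · refine ⟨x + 1, ⟨by linarith, le_rfl⟩, ?_⟩
          linarith [hMm h]
        · push Not at h
          refine ⟨x, ⟨le_rfl, by linarith⟩, ?_⟩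
          have := hPm h.le
          have e1 := hP1 x
          have e2 := hP1 (x + 1)
          have e3 : x + 1 + 1 = x + 2 := by ring
          rw [e3] at e2
          linarith
    · constructor
      · intro y hy
        obtain ⟨i, g, hg, hle⟩ := core_upper P M hPm hMm (P 1) (M 1) hP1 hM1 n p hinj hgap Vp Vm
          hVp' hVm' x y hy
        refine le_trans ?_ hle
        rw [hW]
        refine (ciInf_le (Set.finite_range _).bddBelow i).trans ?_
        gcongr
        rw [hWK]
        exact ciInf_le (Set.finite_range _).bddBelow
          (⟨g, hg⟩ : {f : Fin (n + 1) → Fin (n + 1) // ∀ j, ∃ n, f^[n] j = i})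
      · obtain ⟨i, hi⟩ := exists_eq_ciInf_of_finite
          (f := fun i : Fin (n + 1) => WK i + min (Vp (p i) x) (Vm (p i) x))
        haveI : Nonempty {f : Fin (n + 1) → Fin (n + 1) // ∀ j, ∃ n, f^[n] j = i} :=
          ⟨⟨fun _ => i, fun j => ⟨1, rfl⟩⟩⟩
        obtain ⟨g, hg⟩ := exists_eq_ciInf_of_finite
          (f := fun g : {f : Fin (n + 1) → Fin (n + 1) // ∀ j, ∃ n, f^[n] j = i} =>
            ∑ j ∈ Finset.univ.erase i, min (Vp (p j) (p (g.1 j))) (Vm (p j) (p (g.1 j))))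
        obtain ⟨y, hy, hle⟩ := core_lower P M hPm hMm (n + 1) p hgap Vp Vm hVp' hVm' x i g.1 g.2
        refine ⟨y, hy, hle.trans (le_of_eq ?_)⟩
        rw [hW, ← hi, hWK, ← hg]
  have hΦW : ∀ x, Φ x = W x - P 1 := by
    intro x
    obtain ⟨h1, y, hy, h2⟩ := hmain x
    have hH : ∀ z, M z - M x + (P (x + 1) - P z) = S x - S z + P 1 := by
      intro z
      rw [hSPM, hSPM, hP1]; ring
    rw [hΦ]
    apply le_antisymm
    · have hb : BddBelow ((fun y => S x - S y) '' Icc x (x + 1)) := by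
        refine ⟨W x - P 1, ?_⟩
        rintro _ ⟨z, hz, rfl⟩
        have := h1 z hz
        rw [hH] at this
        simp only; linarith
      have h3 := csInf_le hb ⟨y, hy, rfl⟩
      rw [hH] at h2
      simp only at h3
      linarith
    · apply le_csInf
      · exact ⟨_, y, hy, rfl⟩
      · rintro _ ⟨z, hz, rfl⟩
        have := h1 z hz
        rw [hH] at this
        simp only; linarith
  have hWnn : ∀ x, 0 ≤ W x := by
    intro x
    obtain ⟨_, y, hy, h2⟩ := hmain x
    linarith [hMm hy.1, hPm hy.2]
  have hne : (W '' Icc (0:ℝ) 1).Nonempty := ⟨_, 0, ⟨le_rfl, zero_le_one⟩, rfl⟩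
  have hbW : BddBelow (W '' Icc (0:ℝ) 1) := by
    refine ⟨0, ?_⟩
    rintro _ ⟨z, _, rfl⟩
    exact hWnn z
  have hinf : sInf (Φ '' Icc (0:ℝ) 1) = sInf (W '' Icc (0:ℝ) 1) - P 1 := by
    have hneΦ : (Φ '' Icc (0:ℝ) 1).Nonempty := ⟨_, 0, ⟨le_rfl, zero_le_one⟩, rfl⟩
    have hbΦ : BddBelow (Φ '' Icc (0:ℝ) 1) := by
      refine ⟨0 - P 1, ?_⟩
      rintro _ ⟨z, _, rfl⟩
      rw [hΦW]; linarith [hWnn z]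
    apply le_antisymm
    · have : sInf (Φ '' Icc (0:ℝ) 1) + P 1 ≤ sInf (W '' Icc (0:ℝ) 1) := by
        apply le_csInf hne
        rintro _ ⟨z, hz, rfl⟩
        have := csInf_le hbΦ ⟨z, hz, rfl⟩
        rw [hΦW] at this
        linarith
      linarith
    · apply le_csInf hneΦ
      rintro _ ⟨z, hz, rfl⟩
      have := csInf_le hbW ⟨z, hz, rfl⟩
      rw [hΦW]
      linarith
  intro x
  rw [hinf, hΦW]
  ring
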